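/- With the doubling rule m_1 = 1 and m_i = 2^{i−1}+1 for i ≥ 2, and assuming each univariate operator U^i reproduces all polynomials of degree at most m_i − 1, the Smolyak operator Sm(d+k,d) is exact on all polynomials of total degree at most k: for every polynomial g : ℝ^d → ℝ of total degree ≤ k and every x ∈ [0,1]^d, Sm(d+k,d)(g)(x) = g(x). -/

import Mathlib

noncomputable section

/-- The univariate interpolation operator `U^i(f) = Σ_j f(x^i_j)·a^i_j`
(with `U^0 = 0`, enforced by `m 0 = 0`). -/
def Uop (m : ℕ → ℕ) (pts : ℕ → ℕ → ℝ) (a : ℕ → ℕ → ℝ → ℝ) (i : ℕ) (f : ℝ → ℝ) : ℝ → ℝ :=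
  fun t => ∑ j ∈ Finset.range (m i), f (pts i j) * a i j t

/-- The tensor-product operator `U^{i₁} ⊗ ⋯ ⊗ U^{i_d}`; if some `ι k = 0` then
`m 0 = 0` makes the whole sum (and hence the operator) zero. -/
def Utensor (m : ℕ → ℕ) (pts : ℕ → ℕ → ℝ) (a : ℕ → ℕ → ℝ → ℝ) (d : ℕ)
    (ι : Fin d → ℕ) (f : (Fin d → ℝ) → ℝ) : (Fin d → ℝ) → ℝ :=
  fun y => ∑ j ∈ Fintype.piFinset (fun k => Finset.range (m (ι k))),
    f (fun k => pts (ι k) (j k)) * ∏ k, a (ι k) (j k) (y k)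

/-- The tensor product of difference operators `Δ^{i₁} ⊗ ⋯ ⊗ Δ^{i_d}` with
`Δ^i = U^i − U^{i−1}`, expanded multilinearly. -/
def Dtensor (m : ℕ → ℕ) (pts : ℕ → ℕ → ℝ) (a : ℕ → ℕ → ℝ → ℝ) (d : ℕ)
    (ι : Fin d → ℕ) (f : (Fin d → ℝ) → ℝ) : (Fin d → ℝ) → ℝ :=
  fun y => ∑ ε : Fin d → Bool,
    (-1 : ℝ) ^ (∑ k, (if ε k then 1 else 0 : ℕ)) *
      Utensor m pts a d (fun k => ι k - (if ε k then 1 else 0)) f y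

/-- Smolyak's algorithm `Sm(q,d) = Σ_{𝐢 ≥ 1, ‖𝐢‖₁ ≤ q} Δ^{i₁} ⊗ ⋯ ⊗ Δ^{i_d}`. -/
def Smolyak (m : ℕ → ℕ) (pts : ℕ → ℕ → ℝ) (a : ℕ → ℕ → ℝ → ℝ) (q d : ℕ)
    (f : (Fin d → ℝ) → ℝ) : (Fin d → ℝ) → ℝ :=
  fun y => ∑ ι ∈ (Fintype.piFinset fun _ : Fin d => Finset.Icc 1 q).filter
      (fun ι => ∑ k, ι k ≤ q), Dtensor m pts a d ι f y


theorem Smolyak_sum {σ : Type*} (m : ℕ → ℕ) (pts : ℕ → ℕ → ℝ) (a : ℕ → ℕ → ℝ → ℝ) (q d : ℕ)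
    (s : Finset σ) (c : σ → ℝ) (f : σ → (Fin d → ℝ) → ℝ) (x : Fin d → ℝ) :
    Smolyak m pts a q d (fun y => ∑ e ∈ s, c e * f e y) x =
      ∑ e ∈ s, c e * Smolyak m pts a q d (f e) x := by
  have hU : ∀ ι, Utensor m pts a d ι (fun y => ∑ e ∈ s, c e * f e y) x =
      ∑ e ∈ s, c e * Utensor m pts a d ι (f e) x := by
    intro ι
    simp only [Utensor, Finset.sum_mul, Finset.mul_sum]
    rw [Finset.sum_comm]
    simp only [mul_assoc]
  have hD : ∀ ι, Dtensor m pts a d ι (fun y => ∑ e ∈ s, c e * f e y) x =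
      ∑ e ∈ s, c e * Dtensor m pts a d ι (f e) x := by
    intro ι
    simp only [Dtensor, hU, Finset.mul_sum]
    rw [Finset.sum_comm]
    simp only [mul_left_comm]
  simp only [Smolyak, hD, Finset.mul_sum]
  rw [Finset.sum_comm]

theorem Utensor_prod (m : ℕ → ℕ) (pts : ℕ → ℕ → ℝ) (a : ℕ → ℕ → ℝ → ℝ) (d : ℕ)
    (ι : Fin d → ℕ) (f : Fin d → ℝ → ℝ) (x : Fin d → ℝ) :
    Utensor m pts a d ι (fun y => ∏ k, f k (y k)) x = ∏ k, Uop m pts a (ι k) (f k) (x k) := by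
  simp only [Utensor, Uop, Finset.prod_univ_sum, Finset.prod_mul_distrib]

theorem Dtensor_prod (m : ℕ → ℕ) (pts : ℕ → ℕ → ℝ) (a : ℕ → ℕ → ℝ → ℝ) (d : ℕ)
    (ι : Fin d → ℕ) (f : Fin d → ℝ → ℝ) (x : Fin d → ℝ) :
    Dtensor m pts a d ι (fun y => ∏ k, f k (y k)) x =
      ∏ k, (Uop m pts a (ι k) (f k) (x k) - Uop m pts a (ι k - 1) (f k) (x k)) := by
  have h : ∀ k, Uop m pts a (ι k) (f k) (x k) - Uop m pts a (ι k - 1) (f k) (x k) =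
      ∑ b : Bool, (-1 : ℝ) ^ (if b then 1 else 0 : ℕ) *
        Uop m pts a (ι k - (if b then 1 else 0)) (f k) (x k) := by
    intro k
    simp
    ring
  simp only [h, Dtensor, Utensor_prod, Finset.prod_univ_sum, Fintype.piFinset_univ,
    Finset.prod_mul_distrib, Finset.prod_pow_eq_pow_sum]

theorem sum_Icc_Uop_sub (m : ℕ → ℕ) (pts : ℕ → ℕ → ℝ) (a : ℕ → ℕ → ℝ → ℝ) (hm0 : m 0 = 0)
    (n : ℕ) (f : ℝ → ℝ) (t : ℝ) :
    ∑ i ∈ Finset.Icc 1 n, (Uop m pts a i f t - Uop m pts a (i - 1) f t) = Uop m pts a n f t := by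
  induction n with
  | zero => simp [Uop, hm0]
  | succ n ih =>
    rw [Finset.sum_Icc_succ_top (by omega), ih]
    simp

/-- If every `U^i` with `i ≥ 1` reproduces the powers `t ^ n`, `n < i`, then `Sm(d+k,d)` reproduces
the monomials of total degree at most `k`. -/
theorem Smolyak_prod_pow (m : ℕ → ℕ) (pts : ℕ → ℕ → ℝ) (a : ℕ → ℕ → ℝ → ℝ) (hm0 : m 0 = 0)
    {d k : ℕ} (x : Fin d → ℝ)
    (hU : ∀ i n, n < i → ∀ l, Uop m pts a i (fun u => u ^ n) (x l) = x l ^ n)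
    (e : Fin d → ℕ) (he : ∑ l, e l ≤ k) :
    Smolyak m pts a (d + k) d (fun y => ∏ l, y l ^ e l) x = ∏ l, x l ^ e l := by
  have hprod : ∏ l, x l ^ e l = ∑ ι ∈ Fintype.piFinset fun l => Finset.Icc 1 (e l + 1),
      Dtensor m pts a d ι (fun y => ∏ l, y l ^ e l) x := by
    simp only [Dtensor_prod m pts a d _ (fun l u => u ^ e l)]
    rw [← Finset.prod_univ_sum (fun l => Finset.Icc 1 (e l + 1)) fun l i =>
      Uop m pts a i (fun u => u ^ e l) (x l) - Uop m pts a (i - 1) (fun u => u ^ e l) (x l)]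
    simp only [sum_Icc_Uop_sub m pts a hm0, hU _ _ (Nat.lt_succ_self _)]
  rw [hprod, Smolyak]
  symm
  apply Finset.sum_subset
  · intro ι hι
    simp only [Fintype.mem_piFinset, Finset.mem_Icc, Finset.mem_filter] at hι ⊢
    have hsum : ∑ l, ι l ≤ d + k :=
      calc ∑ l, ι l ≤ ∑ l, (e l + 1) := Finset.sum_le_sum fun l _ => (hι l).2
        _ = ∑ l, e l + d := by simp [Finset.sum_add_distrib]
        _ ≤ d + k := by omega
    exact ⟨fun l => ⟨(hι l).1,
      (Finset.single_le_sum (fun _ _ => Nat.zero_le _) (Finset.mem_univ l)).trans hsum⟩, hsum⟩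
  · intro ι hι hι'
    simp only [Fintype.mem_piFinset, Finset.mem_Icc, Finset.mem_filter] at hι hι'
    push Not at hι'
    obtain ⟨l, hl⟩ := hι'
    have hlt := hl (hι.1 l).1
    rw [Dtensor_prod m pts a d ι (fun l u => u ^ e l)]
    refine Finset.prod_eq_zero (Finset.mem_univ l) ?_
    rw [hU _ _ (by omega), hU _ _ (by omega), sub_self]

/-- with the doubling rule `m₁ = 1`, `m_i = 2^{i−1} + 1` for `i ≥ 2`,
and univariate operators reproducing polynomials of degree at most `m_i − 1`,
the Smolyak operator `Sm(d+k,d)` reproduces every polynomial of total degree ≤ k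
on `[0,1]^d`. -/
theorem smolyak_exact_total_degree
    (m : ℕ → ℕ) (pts : ℕ → ℕ → ℝ) (a : ℕ → ℕ → ℝ → ℝ)
    (hm0 : m 0 = 0) (hm1 : m 1 = 1) (hmdouble : ∀ i, 2 ≤ i → m i = 2 ^ (i - 1) + 1)
    (hpts : ∀ i, 1 ≤ i → ∀ j < m i, pts i j ∈ Set.Icc (0 : ℝ) 1)
    (hdist : ∀ i, 1 ≤ i → ∀ j < m i, ∀ k < m i, pts i j = pts i k → j = k)
    (hacont : ∀ i j, Continuous (a i j))
    (hdelta : ∀ i, 1 ≤ i → ∀ j < m i, ∀ k < m i,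
      a i j (pts i k) = if j = k then 1 else 0)
    (hexact : ∀ i, 1 ≤ i → ∀ p : Polynomial ℝ, p.natDegree ≤ m i - 1 →
      ∀ t ∈ Set.Icc (0 : ℝ) 1, Uop m pts a i (fun u => p.eval u) t = p.eval t)
    (d k : ℕ) (hd : 1 ≤ d)
    (g : MvPolynomial (Fin d) ℝ) (hg : g.totalDegree ≤ k) :
    ∀ x ∈ Set.Icc (0 : Fin d → ℝ) 1,
      Smolyak m pts a (d + k) d (fun y => MvPolynomial.eval y g) x =
        MvPolynomial.eval x g := by
  intro x hx
  have hm : ∀ i, 1 ≤ i → i - 1 ≤ m i - 1 := by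
    intro i hi
    obtain rfl | hi := hi.eq_or_lt
    · omega
    · rw [hmdouble i hi]
      exact Nat.lt_two_pow_self.le
  have hU : ∀ i n, n < i → ∀ l, Uop m pts a i (fun u => u ^ n) (x l) = x l ^ n := by
    intro i n hn l
    simpa using hexact i (by omega) (Polynomial.X ^ n)
      (by rw [Polynomial.natDegree_X_pow]; have := hm i (by omega); omega) (x l)
      ⟨hx.1 l, hx.2 l⟩
  simp only [MvPolynomial.eval_eq']
  rw [Smolyak_sum]
  refine Finset.sum_congr rfl fun e he => ?_
  rw [Smolyak_prod_pow m pts a hm0 x hU]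
  rw [← Finsupp.sum_fintype e (fun _ n => n) fun _ => rfl]
  exact (MvPolynomial.le_totalDegree he).trans hg
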